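/- Suppose Assumptions A1 and A2 hold, 0 < p < (1−q)/2, 4q + s + p − 2 < 0, and 3q + s − p − 1 < 0, and set r = max{q, p−q−s}. Let (x,λ) be a global solution of the dynamical system, let (x_t,λ_t) be the unique saddle point of L_t with t ↦ (x_t,λ_t) continuously differentiable, and let (x*,λ*) be the projection of the origin onto Ω. Then, as t → +∞: L(x(t),λ*) − L(x*,λ*) = O(√(m(t)) t^{(2q+s−p−1+r)/2} + t^{−p}), |f(x(t)) − f(x*)| = O(√(m(t)) t^{(2q+s−p−1+r)/2} + t^{−p}), ‖Ax(t) − b‖ = O(√(m(t)) t^{(2q+s−p−1+r)/2} + t^{−p}), and ‖(x(t)−x_t, λ(t)−λ_t)‖² = O(m(t) t^{2q+s−p−1+r}). -/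

import Mathlib

open Real Filter Asymptotics
open scoped RealInnerProductSpace Topology

/-- First-order characterisation of convexity. -/
theorem ConvexOn.add_inner_gradient_le {X : Type*} [NormedAddCommGroup X]
    [InnerProductSpace ℝ X] [CompleteSpace X] {f : X → ℝ} {u g : X}
    (hconv : ConvexOn ℝ Set.univ f) (hf : HasGradientAt f g u) (w : X) :
    f u + ⟪g, w - u⟫ ≤ f w := by
  have h1 : ConvexOn ℝ Set.univ (f ∘ AffineMap.lineMap (k := ℝ) u w) := by
    simpa using hconv.comp_affineMap (AffineMap.lineMap (k := ℝ) u w)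
  have h2 : HasDerivAt (f ∘ AffineMap.lineMap (k := ℝ) u w) ⟪g, w - u⟫ 0 := by
    have h3 : HasFDerivAt f (InnerProductSpace.toDual ℝ X g)
        (AffineMap.lineMap (k := ℝ) u w 0) := by
      simpa using hf.hasFDerivAt
    simpa using h3.comp_hasDerivAt (0 : ℝ) AffineMap.hasDerivAt_lineMap
  have h4 := h1.le_slope_of_hasDerivAt (Set.mem_univ 0) (Set.mem_univ 1) one_pos h2
  simp [slope_def_field] at h4
  linarith

/-- A function lying below a barrier at time `T` stays below it as long as it satisfies a linear
differential inequality of which the barrier is a strict supersolution. -/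
theorem le_of_linear_differential_inequality {E E' W W' k h : ℝ → ℝ} {T : ℝ}
    (hE : ∀ t ≥ T, HasDerivAt E (E' t) t) (hW : ∀ t ≥ T, HasDerivAt W (W' t) t)
    (hE' : ∀ t ≥ T, E' t ≤ -k t * E t + h t) (hW' : ∀ t ≥ T, -k t * W t + h t < W' t)
    (h0 : E T ≤ W T) : ∀ t ≥ T, E t ≤ W t := by
  intro t ht
  refine image_le_of_deriv_right_lt_deriv_boundary' (a := T) (b := t) (f := E) (f' := E')
    (B := W) (B' := W') ?_ ?_ h0 ?_ ?_ ?_ ⟨ht, le_rfl⟩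
  · exact fun u hu => (hE u hu.1).continuousAt.continuousWithinAt
  · exact fun u hu => (hE u hu.1).hasDerivWithinAt
  · exact fun u hu => (hW u hu.1).continuousAt.continuousWithinAt
  · exact fun u hu => (hW u hu.1).hasDerivWithinAt
  · intro u hu huW
    have := hE' u hu.1
    rw [huW] at this
    exact this.trans_lt (hW' u hu.1)

theorem HasDerivAt.inner_nonpos {V : Type*} [NormedAddCommGroup V] [InnerProductSpace ℝ V]
    {U : Type*} [NormedAddCommGroup U] [InnerProductSpace ℝ U]
    {u v : ℝ → V} {u' v' : V} {w z : ℝ → U} {w' z' : U} {t : ℝ}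
    (hu : HasDerivAt u u' t) (hv : HasDerivAt v v' t)
    (hw : HasDerivAt w w' t) (hz : HasDerivAt z z' t)
    (h : ∀ᶠ τ in 𝓝 t, ⟪u τ - u t, v τ - v t⟫ + ⟪w τ - w t, z τ - z t⟫ ≤ 0) :
    ⟪u', v'⟫ + ⟪w', z'⟫ ≤ 0 := by
  rw [hasDerivAt_iff_tendsto_slope] at hu hv hw hz
  refine le_of_tendsto ((hu.inner hv).add (hw.inner hz)) ?_
  filter_upwards [h.filter_mono nhdsWithin_le_nhds] with τ hτ
  simp only [slope_def_module, inner_smul_left, inner_smul_right, conj_trivial, ← mul_assoc,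
    ← mul_add]
  exact mul_nonpos_of_nonneg_of_nonpos (mul_self_nonneg _) hτ

theorem mul_mul_le_of_sq_le {k ρ τ B u V : ℝ} (hk : 0 < k) (hρ : 0 < ρ) (h : τ ^ 2 ≤ ρ * B) :
    u * V * τ ≤ k * ρ * V ^ 2 + u ^ 2 / (4 * k) * B := by
  have h1 : u * V * τ ≤ k * ρ * V ^ 2 + u ^ 2 * τ ^ 2 / (4 * k * ρ) := by
    have : k * ρ * V ^ 2 + u ^ 2 * τ ^ 2 / (4 * k * ρ) - u * V * τ
      = (2 * k * ρ * V - u * τ) ^ 2 / (4 * k * ρ) := by field_simp; ring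
    have : 0 ≤ (2 * k * ρ * V - u * τ) ^ 2 / (4 * k * ρ) := by positivity
    linarith
  have h2 : u ^ 2 * τ ^ 2 / (4 * k * ρ) ≤ u ^ 2 / (4 * k) * B := by
    rw [div_mul_eq_mul_div, div_le_div_iff₀ (by positivity) (by positivity)]
    have : 0 ≤ u ^ 2 * (4 * k) := by positivity
    nlinarith [mul_le_mul_of_nonneg_left h this]
  linarith

theorem hasDerivAt_div_rpow (c p : ℝ) {t : ℝ} (ht : 0 < t) :
    HasDerivAt (fun τ : ℝ => c / τ ^ p) (-(p * (c / t ^ p) / t)) t := by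
  have h := ((hasDerivAt_rpow_const (p := p) (Or.inl ht.ne')).inv
    (rpow_pos_of_pos ht p).ne').const_mul c
  refine h.congr_deriv ?_
  rw [rpow_sub_one ht.ne']
  have := (rpow_pos_of_pos ht p).ne'
  field_simp

section RegularizedSaddle

variable {X Y : Type*} [NormedAddCommGroup X] [InnerProductSpace ℝ X] [CompleteSpace X]
  [NormedAddCommGroup Y] [InnerProductSpace ℝ Y] [CompleteSpace Y]
  {f : X → ℝ} {f' : X → X} {A : X →L[ℝ] Y} {b : Y}

/-- The gradient of a convex function is monotone. -/
theorem ConvexOn.inner_gradient_sub_nonneg (hconv : ConvexOn ℝ Set.univ f)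
    (hf : ∀ u, HasGradientAt f (f' u) u) (u w : X) : 0 ≤ ⟪f' u - f' w, u - w⟫ := by
  have h1 := hconv.add_inner_gradient_le (hf u) w
  have h2 := hconv.add_inner_gradient_le (hf w) u
  rw [← neg_sub u w, inner_neg_right] at h1
  rw [inner_sub_left]
  linarith

/-- The saddle point of the regularized Lagrangian is no larger than any saddle point of the
Lagrangian. -/
theorem norm_sq_regularized_saddle_le (hconv : ConvexOn ℝ Set.univ f)
    (hf : ∀ u, HasGradientAt f (f' u) u) {ε : ℝ} (hε : 0 < ε) {u xs : X} {l ls : Y}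
    (h1 : f' u + ContinuousLinearMap.adjoint A l + ε • u = 0) (h2 : A u - b - ε • l = 0)
    (hb : A xs = b) (hs : ∀ w, f xs ≤ f w + ⟪ls, A w - b⟫) :
    ‖u‖ ^ 2 + ‖l‖ ^ 2 ≤ ‖xs‖ ^ 2 + ‖ls‖ ^ 2 := by
  have h3 := hconv.add_inner_gradient_le (hf u) xs
  have h4 := hs u
  have e1 : f' u = -(ContinuousLinearMap.adjoint A l) - ε • u := by
    linear_combination (norm := module) h1
  have e2 : A u - b = ε • l := by linear_combination (norm := module) h2
  have e3 : A (xs - u) = -(ε • l) := by rw [map_sub, hb, ← e2]; abel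
  rw [e1, inner_sub_left, inner_neg_left, ContinuousLinearMap.adjoint_inner_left, e3] at h3
  rw [e2] at h4
  simp only [inner_neg_right, inner_smul_right, inner_smul_left, inner_sub_right, conj_trivial,
    real_inner_self_eq_norm_sq] at h3 h4
  have h5 : ‖u‖ ^ 2 + ‖l‖ ^ 2 ≤ ⟪u, xs⟫ + ⟪ls, l⟫ := by
    refine le_of_mul_le_mul_left ?_ hε
    linarith
  have h6 := norm_sub_sq_real u xs
  have h7 := norm_sub_sq_real ls l
  nlinarith [sq_nonneg ‖u - xs‖, sq_nonneg ‖ls - l‖]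

/-- The velocity of the path of regularized saddle points is `O(1/t)`. -/
theorem norm_sq_deriv_regularized_saddle_le (hconv : ConvexOn ℝ Set.univ f)
    (hf : ∀ u, HasGradientAt f (f' u) u) {c p t : ℝ} (hc : 0 < c) (hp0 : 0 < p) (hp1 : p < 1)
    (ht : 0 < t) {xt : ℝ → X} {lt : ℝ → Y} {xd : X} {ld : Y}
    (hxt : HasDerivAt xt xd t) (hlt : HasDerivAt lt ld t)
    (h1 : ∀ᶠ τ in 𝓝 t, f' (xt τ) + ContinuousLinearMap.adjoint A (lt τ)
      + (c / τ ^ p) • xt τ = 0)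
    (h2 : ∀ᶠ τ in 𝓝 t, A (xt τ) - b - (c / τ ^ p) • lt τ = 0) :
    ‖xd‖ ^ 2 + ‖ld‖ ^ 2 ≤ (‖xt t‖ ^ 2 + ‖lt t‖ ^ 2) / t ^ 2 := by
  have hε := hasDerivAt_div_rpow c p ht
  have hεx := hε.smul hxt
  have hεl := hε.smul hlt
  have key := HasDerivAt.inner_nonpos hεx hxt hlt hεl (by
    filter_upwards [h1, h2] with τ hτ1 hτ2
    have h01 := h1.self_of_nhds
    have h02 := h2.self_of_nhds
    have hm := hconv.inner_gradient_sub_nonneg hf (xt τ) (xt t)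
    have e1 : f' (xt τ) - f' (xt t) = -(ContinuousLinearMap.adjoint A (lt τ - lt t))
        - ((c / τ ^ p) • xt τ - (c / t ^ p) • xt t) := by
      rw [map_sub]
      linear_combination (norm := module) hτ1 - h01
    have e2 : A (xt τ - xt t) = (c / τ ^ p) • lt τ - (c / t ^ p) • lt t := by
      rw [map_sub]
      linear_combination (norm := module) hτ2 - h02
    rw [e1, inner_sub_left, inner_neg_left, ContinuousLinearMap.adjoint_inner_left, e2] at hm
    simp only [Pi.smul_apply'] at hm ⊢
    linarith)
  simp only [inner_add_left, inner_add_right, inner_smul_left, inner_smul_right, conj_trivial,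
    real_inner_self_eq_norm_sq] at key
  set ε := c / t ^ p
  have hεpos : 0 < ε := div_pos hc (rpow_pos_of_pos ht p)
  have h3 : ‖xd‖ ^ 2 + ‖ld‖ ^ 2 ≤ p / t * (⟪xt t, xd⟫ + ⟪lt t, ld⟫) := by
    refine le_of_mul_le_mul_left ?_ hεpos
    rw [real_inner_comm (lt t) ld] at key
    have e : ε * (p / t * (⟪xt t, xd⟫ + ⟪lt t, ld⟫))
      = p * ε / t * (⟪xt t, xd⟫ + ⟪lt t, ld⟫) := by ring
    rw [e]
    linarith
  have h4 := norm_sub_sq_real xd ((p / t) • xt t)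
  have h5 := norm_sub_sq_real ld ((p / t) • lt t)
  simp only [inner_smul_right, norm_smul, mul_pow, norm_eq_abs, sq_abs,
    real_inner_comm (xt t) xd, real_inner_comm (lt t) ld] at h4 h5
  have h6 : (p / t) ^ 2 * (‖xt t‖ ^ 2 + ‖lt t‖ ^ 2) ≤ (‖xt t‖ ^ 2 + ‖lt t‖ ^ 2) / t ^ 2 := by
    rw [div_pow, div_mul_eq_mul_div]
    gcongr
    have : p ^ 2 ≤ 1 := by nlinarith
    exact mul_le_of_le_one_left (by positivity) this
  nlinarith [sq_nonneg ‖xd - (p / t) • xt t‖, sq_nonneg ‖ld - (p / t) • lt t‖]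

end RegularizedSaddle

theorem hasDerivAt_momentum {X : Type*} [NormedAddCommGroup X] [InnerProductSpace ℝ X]
    {α γ a β η t S md Pd : ℝ} {x x' xt g : ℝ → X} {P m : ℝ → ℝ}
    {xdd xtd gd : X}
    (hx : HasDerivAt x (x' t) t) (hx' : HasDerivAt x' xdd t) (hxt : HasDerivAt xt xtd t)
    (hg : HasDerivAt g gd t) (hP : HasDerivAt P Pd t) (hm : HasDerivAt m md t)
    (hP0 : P t ≠ 0) (hα : α = a + 1) (hη : η = 1 - Pd * m t - P t * md)
    (hβ : β = P t * S - γ * Pd)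
    (hode : m t • xdd + (α / P t) • x' t + γ • gd + S • g t = 0) :
    HasDerivAt (fun τ => a • (x τ - xt τ) + P τ • (m τ • x' τ + γ • g τ))
      (-(η • x' t) - a • xtd - β • g t) t := by
  have d := ((hx.sub hxt).const_smul a).add (hP.smul ((hm.smul hx').add (hg.const_smul γ)))
  refine d.congr_deriv ?_
  have h := congrArg (fun z => P t • z) hode
  simp only [smul_add, smul_zero, smul_smul, mul_div_cancel₀ α hP0] at h
  simp only [Pi.add_apply, Pi.smul_apply', Pi.smul_apply]
  subst hα hη hβ
  linear_combination (norm := module) h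

theorem energy_derivative_identity {X Y : Type*} [NormedAddCommGroup X] [InnerProductSpace ℝ X]
    [NormedAddCommGroup Y] [InnerProductSpace ℝ Y] {A : X →L[ℝ] Y}
    {y w g zx : X} {ℓ zl : Y} {a β η N P m γ ε κ Q : ℝ}
    (hN : N = P * (γ * η + β * m)) :
    N * (⟪g, w⟫ - ⟪ℓ, A w⟫ + ⟪zl, A y⟫ - κ * Q)
      + ⟪a • y + P • (m • w + γ • g), -(η • w) - a • zx - β • g⟫
      + η * a * ⟪y, w - zx⟫
      + ⟪ℓ, (a * β) • (A y - ε • ℓ) + N • A w - zl⟫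
    = -(a * β * (⟪g, y⟫ - ⟪ℓ, A y⟫)) - η * m * P * ‖w‖ ^ 2 - γ * β * P * ‖g‖ ^ 2
      - a * β * ε * ‖ℓ‖ ^ 2 - a * ⟪a • y + P • (m • w + γ • g), zx⟫ - η * a * ⟪y, zx⟫
      - ⟪ℓ, zl⟫ + N * ⟪zl, A y⟫ - N * κ * Q := by
  simp only [inner_add_left, inner_sub_right, inner_add_right, inner_neg_right, inner_smul_left,
    inner_smul_right, conj_trivial, real_inner_self_eq_norm_sq]
  rw [real_inner_comm g w, real_inner_comm g y]
  subst hN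
  ring

section Energy

variable {X Y : Type*} [NormedAddCommGroup X] [InnerProductSpace ℝ X] [CompleteSpace X]
  [NormedAddCommGroup Y] [InnerProductSpace ℝ Y] [CompleteSpace Y]
  {f : X → ℝ} {f' : X → X} {A : X →L[ℝ] Y} {b : Y}

theorem half_mul_norm_sq_le_gap (hconv : ConvexOn ℝ Set.univ f)
    (hf : ∀ u, HasGradientAt f (f' u) u) {ε : ℝ} {u w : X} {l : Y}
    (h1 : f' u + ContinuousLinearMap.adjoint A l + ε • u = 0) :
    ε / 2 * ‖w - u‖ ^ 2 ≤ f w - f u + ⟪l, A (w - u)⟫ + ε / 2 * (‖w‖ ^ 2 - ‖u‖ ^ 2) := by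
  have h3 := hconv.add_inner_gradient_le (hf u) w
  have e1 : f' u = -(ContinuousLinearMap.adjoint A l) - ε • u := by
    linear_combination (norm := module) h1
  rw [e1, inner_sub_left, inner_neg_left, ContinuousLinearMap.adjoint_inner_left] at h3
  simp only [inner_smul_left, inner_sub_right, conj_trivial, real_inner_self_eq_norm_sq] at h3
  rw [norm_sub_sq_real w u, real_inner_comm]
  linarith

theorem gap_le_inner (hconv : ConvexOn ℝ Set.univ f)
    (hf : ∀ u, HasGradientAt f (f' u) u) {ε : ℝ} {u w g : X} {l k : Y}
    (hg : g = f' w + ContinuousLinearMap.adjoint A k + ε • w) :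
    f w - f u + ⟪l, A (w - u)⟫ + ε / 2 * (‖w‖ ^ 2 - ‖u‖ ^ 2)
      ≤ ⟪g, w - u⟫ - ⟪k - l, A (w - u)⟫ - ε / 2 * ‖w - u‖ ^ 2 := by
  have h3 := hconv.add_inner_gradient_le (hf w) u
  rw [← neg_sub w u, inner_neg_right] at h3
  rw [hg, inner_add_left, inner_add_left, ContinuousLinearMap.adjoint_inner_left,
    inner_sub_left k l, norm_sub_sq_real w u]
  simp only [inner_smul_left, inner_sub_right w, conj_trivial, real_inner_self_eq_norm_sq]
  linarith

theorem hasDerivAt_gap (hf : ∀ u, HasGradientAt f (f' u) u) {c p t : ℝ} (ht : 0 < t)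
    {x xt : ℝ → X} {lt : ℝ → Y} {xd xtd g : X} {ltd k : Y}
    (hx : HasDerivAt x xd t) (hxt : HasDerivAt xt xtd t) (hlt : HasDerivAt lt ltd t)
    (hg : g = f' (x t) + ContinuousLinearMap.adjoint A k + (c / t ^ p) • x t)
    (h1 : f' (xt t) + ContinuousLinearMap.adjoint A (lt t) + (c / t ^ p) • xt t = 0) :
    HasDerivAt (fun τ => f (x τ) - f (xt τ) + ⟪lt τ, A (x τ - xt τ)⟫
        + (c / τ ^ p) / 2 * (‖x τ‖ ^ 2 - ‖xt τ‖ ^ 2))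
      (⟪g, xd⟫ - ⟪k - lt t, A xd⟫ + ⟪ltd, A (x t - xt t)⟫
        - p * (c / t ^ p) / t / 2 * (‖x t‖ ^ 2 - ‖xt t‖ ^ 2)) t := by
  have d1 : HasDerivAt (fun τ => f (x τ)) ⟪f' (x t), xd⟫ t := (hf (x t)).hasFDerivAt.comp_hasDerivAt t hx
  have d2 : HasDerivAt (fun τ => f (xt τ)) ⟪f' (xt t), xtd⟫ t := 
    (hf (xt t)).hasFDerivAt.comp_hasDerivAt t hxt
  have d3 : HasDerivAt (fun τ => A (x τ - xt τ)) (A (xd - xtd)) t :=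
    A.hasFDerivAt.comp_hasDerivAt t (hx.sub hxt)
  have d4 := (((d1.sub d2).add (hlt.inner ℝ d3)).add
    (((hasDerivAt_div_rpow c p ht).div_const 2).mul (hx.norm_sq.sub hxt.norm_sq)))
  refine d4.congr_deriv ?_
  have e1 : f' (xt t) = -(ContinuousLinearMap.adjoint A (lt t)) - (c / t ^ p) • xt t := by
    linear_combination (norm := module) h1
  have e2 : f' (x t) = g - ContinuousLinearMap.adjoint A k - (c / t ^ p) • x t := by
    rw [hg]; abel
  rw [e1, e2]
  simp only [inner_sub_left, inner_neg_left, ContinuousLinearMap.adjoint_inner_left,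
    inner_smul_left, conj_trivial, map_sub, inner_sub_right, Pi.sub_apply]
  ring

/-- Differentiating the Lyapunov energy along a trajectory. -/
theorem exists_hasDerivAt_energy_le (hconv : ConvexOn ℝ Set.univ f)
    (hf : ∀ u, HasGradientAt f (f' u) u) {c p t α γ a β S md Pd Nd ηd : ℝ} (ht : 0 < t)
    {x x' xt g : ℝ → X} {lam lt : ℝ → Y} {P m N η : ℝ → ℝ} {xdd xtd gd : X} {lamd ltd : Y}
    (hx : HasDerivAt x (x' t) t) (hx' : HasDerivAt x' xdd t) (hxt : HasDerivAt xt xtd t)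
    (hlam : HasDerivAt lam lamd t) (hlt : HasDerivAt lt ltd t)
    (hg : HasDerivAt g gd t) (hP : HasDerivAt P Pd t) (hm : HasDerivAt m md t)
    (hNd : HasDerivAt N Nd t) (hηd : HasDerivAt η ηd t)
    (hP0 : P t ≠ 0) (hα : α = a + 1) (hη : η t = 1 - Pd * m t - P t * md)
    (hβ : β = P t * S - γ * Pd) (hN : N t = P t * (γ * η t + β * m t))
    (hode : m t • xdd + (α / P t) • x' t + γ • gd + S • g t = 0)
    (hgt : g t = f' (x t) + ContinuousLinearMap.adjoint A (lam t) + (c / t ^ p) • x t)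
    (hlamd : lamd = (a * β) • (A (x t) - b - (c / t ^ p) • lam t) + N t • A (x' t))
    (h1 : f' (xt t) + ContinuousLinearMap.adjoint A (lt t) + (c / t ^ p) • xt t = 0)
    (h2 : A (xt t) - b - (c / t ^ p) • lt t = 0) (ha : 0 ≤ a) (hβ0 : 0 ≤ β) :
    ∃ E', HasDerivAt (fun τ => N τ * (f (x τ) - f (xt τ) + ⟪lt τ, A (x τ - xt τ)⟫
        + (c / τ ^ p) / 2 * (‖x τ‖ ^ 2 - ‖xt τ‖ ^ 2))
        + ‖a • (x τ - xt τ) + P τ • (m τ • x' τ + γ • g τ)‖ ^ 2 / 2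
        + η τ * (a / 2 * ‖x τ - xt τ‖ ^ 2) + ‖lam τ - lt τ‖ ^ 2 / 2) E' t ∧
      E' ≤ (Nd - a * β) * (f (x t) - f (xt t) + ⟪lt t, A (x t - xt t)⟫
        + (c / t ^ p) / 2 * (‖x t‖ ^ 2 - ‖xt t‖ ^ 2))
        - a * β * (c / t ^ p) / 2 * ‖x t - xt t‖ ^ 2
        - η t * m t * P t * ‖x' t‖ ^ 2 - γ * β * P t * ‖g t‖ ^ 2
        - a * β * (c / t ^ p) * ‖lam t - lt t‖ ^ 2
        + ηd * (a / 2 * ‖x t - xt t‖ ^ 2)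
        - a * ⟪a • (x t - xt t) + P t • (m t • x' t + γ • g t), xtd⟫
        - η t * a * ⟪x t - xt t, xtd⟫ - ⟪lam t - lt t, ltd⟫
        + N t * ⟪ltd, A (x t - xt t)⟫
        - N t * (p * (c / t ^ p) / t / 2) * (‖x t‖ ^ 2 - ‖xt t‖ ^ 2) := by
  have dG := hasDerivAt_gap hf ht hx hxt hlt hgt h1
  have dv := hasDerivAt_momentum hx hx' hxt hg hP hm hP0 hα hη hβ hode
  refine ⟨_, (((hNd.mul dG).add (dv.norm_sq.div_const 2)).add
    (hηd.mul ((hx.sub hxt).norm_sq.const_mul (a / 2)))).add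
      ((hlam.sub hlt).norm_sq.div_const 2), ?_⟩
  have hl : lamd = (a * β) • (A (x t - xt t) - (c / t ^ p) • (lam t - lt t))
      + N t • A (x' t) := by
    rw [hlamd, map_sub]
    linear_combination (norm := module) (a * β) • h2
  have key := energy_derivative_identity (A := A) (y := x t - xt t) (w := x' t) (g := g t)
    (zx := xtd) (ℓ := lam t - lt t) (zl := ltd) (a := a) (ε := c / t ^ p)
    (κ := p * (c / t ^ p) / t / 2) (Q := ‖x t‖ ^ 2 - ‖xt t‖ ^ 2) hN
  rw [← hl] at key
  have hgap := mul_le_mul_of_nonneg_left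
    (gap_le_inner (l := lt t) (u := xt t) hconv hf hgt) (mul_nonneg ha hβ0)
  simp only [Pi.sub_apply] at *
  linarith

/-- Absorbing the cross terms of the energy balance into the dissipation. -/
theorem energy_balance_le {D Y V W G L a β ε η ηd N Nd M P γ ρ τ R nA p c₂ C₁ C₂ C₃ k₁ κ : ℝ}
    (hD : 0 ≤ D) (hY : 0 ≤ Y)
    (ha : 0 < a) (hβ : 0 < β) (hε : 0 < ε) (hρ : 0 < ρ) (hρ1 : ρ ≤ 1) (hτ : 0 < τ) (hR : 0 ≤ R)
    (hγ : 0 < γ) (hP : 0 < P) (hc₂ : 0 < c₂) (hM : 0 ≤ M) (hN : 0 ≤ N)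
    (hκ : 0 < κ) (hη1 : 1 / 2 ≤ η) (hη2 : η ≤ 2)
    (hV : V ^ 2 ≤ 3 * (a ^ 2 * Y ^ 2 + M ^ 2 * W ^ 2 + γ ^ 2 * P ^ 2 * G ^ 2))
    (hNd : Nd ≤ a * β / 2) (hNβ : N ≤ C₁ * β) (hβε : c₂ * ρ ≤ β * ε)
    (hMk : M ≤ k₁) (hPβ : P ≤ 2 * β) (hηd : ηd ≤ c₂ / 8 * ρ)
    (hτ2 : τ ^ 2 ≤ ρ * (C₂ * (N * ε * τ))) (hτε : τ ≤ C₃ * ε ^ 2)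
    (hκ1 : κ * C₁ ≤ a / 2) (hκ2 : κ * (6 * k₁) ≤ 1) (hκ3 : κ * (6 * γ) ≤ 1)
    (hκ4 : κ * (3 * a + 1) ≤ c₂ / 8) (hκ5 : κ ≤ a * c₂) :
    (Nd - a * β) * D - a * β * ε / 2 * Y ^ 2 - η * M * W ^ 2 - γ * β * P * G ^ 2
      - a * β * ε * L ^ 2 + ηd * (a / 2 * Y ^ 2) + a * V * (R * τ) + η * a * (Y * (R * τ))
      + L * (R * τ) + N * (R * τ * (nA * Y)) + N * (p * ε * τ / 2) * R ^ 2
    ≤ -(κ * ρ) * (N * D + V ^ 2 / 2 + η * (a / 2 * Y ^ 2) + L ^ 2 / 2)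
      + (a ^ 2 * R ^ 2 / (2 * κ) * C₂ + 16 * a * R ^ 2 / c₂ * C₂ + R ^ 2 / (2 * a * c₂) * C₂
        + nA ^ 2 * R ^ 2 / a * (C₁ * C₃) + p / 2 * R ^ 2) * (N * ε * τ) := by
  set B := N * ε * τ with hB
  have tD : (Nd - a * β) * D ≤ -(κ * ρ) * (N * D) := by
    have h1 : κ * ρ * N ≤ a * β / 2 := by
      calc κ * ρ * N ≤ κ * 1 * N := by gcongr
        _ ≤ κ * (C₁ * β) := by rw [mul_one]; gcongr
        _ = κ * C₁ * β := by ring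
        _ ≤ a / 2 * β := by gcongr
        _ = a * β / 2 := by ring
    nlinarith
  have tV : a * V * (R * τ) ≤ κ / 2 * ρ * V ^ 2 + a ^ 2 * R ^ 2 / (2 * κ) * C₂ * B := by
    have h := mul_mul_le_of_sq_le (u := a * R) (V := V) (half_pos hκ) hρ hτ2
    have e : (a * R) ^ 2 / (4 * (κ / 2)) * (C₂ * B) = a ^ 2 * R ^ 2 / (2 * κ) * C₂ * B := by
      field_simp; ring
    linarith
  have tV2 : κ * ρ * V ^ 2 ≤ κ * ρ * (3 * a ^ 2) * Y ^ 2 + η * M * W ^ 2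
      + γ * β * P * G ^ 2 := by
    have h1 : κ * ρ * 3 * M ^ 2 ≤ η * M := by
      calc κ * ρ * 3 * M ^ 2 ≤ κ * 1 * 3 * M ^ 2 := by gcongr
        _ = κ * 3 * M * M := by ring
        _ ≤ κ * 3 * k₁ * M := by gcongr
        _ ≤ η * M := by gcongr; linarith
    have h2 : κ * ρ * 3 * (γ ^ 2 * P ^ 2) ≤ γ * β * P := by
      calc κ * ρ * 3 * (γ ^ 2 * P ^ 2) ≤ κ * 1 * 3 * (γ ^ 2 * P ^ 2) := by gcongr
        _ = κ * (6 * γ) * (γ * P * P / 2) := by ring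
        _ ≤ 1 * (γ * P * P / 2) := by gcongr
        _ ≤ 1 * (γ * P * (2 * β) / 2) := by gcongr
        _ = γ * β * P := by ring
    have h3 := mul_le_mul_of_nonneg_right h1 (sq_nonneg W)
    have h4 := mul_le_mul_of_nonneg_right h2 (sq_nonneg G)
    have h5 := mul_le_mul_of_nonneg_left hV (mul_pos hκ hρ).le
    linarith
  have hac : 0 < a * c₂ := mul_pos ha hc₂
  have tY : η * a * (Y * (R * τ)) ≤ a * c₂ / 16 * ρ * Y ^ 2 + 16 * a * R ^ 2 / c₂ * C₂ * B := by
    have h := mul_mul_le_of_sq_le (u := 2 * a * R) (V := Y) (k := a * c₂ / 16)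
      (by positivity) hρ hτ2
    have e : (2 * a * R) ^ 2 / (4 * (a * c₂ / 16)) * (C₂ * B) = 16 * a * R ^ 2 / c₂ * C₂ * B := by
      field_simp; ring
    have h' : η * a * (Y * (R * τ)) ≤ 2 * a * (Y * (R * τ)) := by gcongr
    linarith
  have tL : L * (R * τ) ≤ a * c₂ / 2 * ρ * L ^ 2 + R ^ 2 / (2 * a * c₂) * C₂ * B := by
    have h := mul_mul_le_of_sq_le (u := R) (V := L) (k := a * c₂ / 2)
      (by positivity) hρ hτ2
    have e : R ^ 2 / (4 * (a * c₂ / 2)) * (C₂ * B) = R ^ 2 / (2 * a * c₂) * C₂ * B := by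
      field_simp; ring
    linarith
  have tN : N * (R * τ * (nA * Y)) ≤ a / 4 * (β * ε) * Y ^ 2
      + nA ^ 2 * R ^ 2 / a * (C₁ * C₃) * B := by
    have hs : (N * τ) ^ 2 ≤ β * ε * (C₁ * C₃ * B) := by
      calc (N * τ) ^ 2 = N * τ * N * τ := by ring
        _ ≤ N * τ * (C₁ * β) * (C₃ * ε ^ 2) := by
          have : 0 ≤ C₁ * β := hN.trans hNβ
          gcongr
        _ = β * ε * (C₁ * C₃ * B) := by rw [hB]; ring
    have h := mul_mul_le_of_sq_le (u := R * nA) (V := Y) (k := a / 4)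
      (by positivity) (mul_pos hβ hε) hs
    have e : (R * nA) ^ 2 / (4 * (a / 4)) * (C₁ * C₃ * B)
        = nA ^ 2 * R ^ 2 / a * (C₁ * C₃) * B := by
      field_simp
    linarith
  have tη : ηd * (a / 2 * Y ^ 2) ≤ a * c₂ / 16 * ρ * Y ^ 2 := by
    have := mul_le_mul_of_nonneg_right hηd (show 0 ≤ a / 2 * Y ^ 2 by positivity)
    linarith
  have tκ : κ * ρ * (3 * a ^ 2) * Y ^ 2 + κ * ρ * (η * (a / 2 * Y ^ 2))
      ≤ a * c₂ / 8 * ρ * Y ^ 2 := by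
    have h0 : 0 ≤ a * ρ * Y ^ 2 := by positivity
    have h1 := mul_le_mul_of_nonneg_right hκ4 h0
    have h2 : κ * ρ * (η * (a / 2 * Y ^ 2)) ≤ κ * ρ * (2 * (a / 2 * Y ^ 2)) := by gcongr
    linarith
  have tβY : a * c₂ / 4 * ρ * Y ^ 2 ≤ a / 4 * (β * ε) * Y ^ 2 := by
    have := mul_le_mul_of_nonneg_right hβε (show 0 ≤ a / 4 * Y ^ 2 by positivity)
    linarith
  have tβL : a * c₂ * ρ * L ^ 2 ≤ a * β * ε * L ^ 2 := by
    have := mul_le_mul_of_nonneg_right hβε (show 0 ≤ a * L ^ 2 by positivity)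
    linarith
  have tκL : κ * ρ * L ^ 2 ≤ a * c₂ * ρ * L ^ 2 := by gcongr
  have tR : N * (p * ε * τ / 2) * R ^ 2 = p / 2 * R ^ 2 * B := by rw [hB]; ring
  linarith

end Energy

/-- Bounds on the scalar coefficients of the energy, where `P`, `S`, `τ` stand for
`t ^ q`, `t ^ s`, `1 / t`. -/
theorem energy_coefficient_bounds {P S τ m md mdd γ q s k₁ k₂ a N Nd β η ηd : ℝ}
    (hP : 1 ≤ P) (hS : 1 ≤ S) (hτ : 0 < τ) (hτ1 : τ ≤ 1) (hm : 0 < m) (hγ : 0 < γ)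
    (hq0 : 0 < q) (hq1 : q < 1) (hs : 0 < s) (hk₁ : 0 < k₁) (hk₂ : 0 < k₂)
    (hA1 : γ ≤ m * (P * S)) (hA1' : m * P ≤ k₁)
    (hmd : |md| ≤ k₂ * m * τ) (hmdd : |mdd| ≤ k₂ * m * τ ^ 2)
    (hN : N = m * (P ^ 2 * S) + γ * P - 2 * γ * q * (m * P ^ 2 * τ) - γ * (md * P ^ 2))
    (hNd : Nd = md * (P ^ 2 * S) + m * ((2 * q + s) * P ^ 2 * S * τ) + γ * (q * P * τ)
      - 2 * γ * q * (md * P ^ 2 * τ + m * ((2 * q - 1) * P ^ 2 * τ ^ 2))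
      - γ * (mdd * P ^ 2 + md * (2 * q * P ^ 2 * τ)))
    (hβ : β = P * S - γ * (q * P * τ)) (hη : η = 1 - q * P * τ * m - P * md)
    (hηd : ηd = q * (1 - q) * P * τ ^ 2 * m - 2 * q * P * τ * md - P * mdd)
    (h1 : τ * (2 * γ * q) ≤ 1) (h2 : τ * (2 * γ * q + γ * k₂) ≤ 1 / 2)
    (h3 : τ * (q * k₁ + k₂ * k₁) ≤ 1 / 2)
    (h4 : τ * (k₁ * (k₂ + (2 * q + s) + q + 2 * γ * q * k₂ + 2 * γ * q + γ * k₂ + 2 * γ * q * k₂))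
      ≤ a / 4) (ha : 0 < a) :
    P * S / 2 ≤ β ∧ m * (P ^ 2 * S) / 2 ≤ N ∧ N ≤ 3 * (m * (P ^ 2 * S)) ∧ N ≤ 6 * k₁ * β ∧
      1 / 2 ≤ η ∧ η ≤ 2 ∧ ηd ≤ (k₁ + 3 * k₂ * k₁) * τ ^ 2 ∧ Nd ≤ a * β / 2 := by
  have hP0 : 0 < P := by linarith
  have hS0 : 0 < S := by linarith
  obtain ⟨hmd1, hmd2⟩ := abs_le.mp hmd
  obtain ⟨hmdd1, hmdd2⟩ := abs_le.mp hmdd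
  set J := m * (P ^ 2 * S) with hJ
  have hJ0 : 0 < J := by positivity
  have hJk : J ≤ k₁ * (P * S) := by
    calc J = m * P * (P * S) := by rw [hJ]; ring
      _ ≤ k₁ * (P * S) := by gcongr
  have hγJ : γ * P ≤ J := by
    calc γ * P ≤ m * (P * S) * P := by gcongr
      _ = J := by rw [hJ]; ring
  have hmPJ : m * P ^ 2 ≤ J := by
    rw [hJ]; gcongr; exact le_mul_of_one_le_right (by positivity) hS
  have hmPτ : m * P * τ ≤ k₁ * τ := by gcongr
  have hmPττ : m * P * τ ^ 2 ≤ k₁ * τ ^ 2 := by gcongr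
  have hmPJτ : m * P ^ 2 * τ ≤ J * τ := by gcongr
  have hmPJττ : m * P ^ 2 * τ ^ 2 ≤ J * τ := by
    calc m * P ^ 2 * τ ^ 2 = m * P ^ 2 * τ * τ := by ring
      _ ≤ J * τ * 1 := by gcongr
      _ = J * τ := by ring
  have hPmd : |P * md| ≤ k₂ * k₁ * τ := by
    rw [abs_mul, abs_of_pos hP0]
    calc P * |md| ≤ P * (k₂ * m * τ) := by gcongr
      _ = k₂ * (m * P * τ) := by ring
      _ ≤ k₂ * (k₁ * τ) := by gcongr
      _ = k₂ * k₁ * τ := by ring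
  have hPmdd : |P * mdd| ≤ k₂ * k₁ * τ ^ 2 := by
    rw [abs_mul, abs_of_pos hP0]
    calc P * |mdd| ≤ P * (k₂ * m * τ ^ 2) := by gcongr
      _ = k₂ * (m * P * τ ^ 2) := by ring
      _ ≤ k₂ * (k₁ * τ ^ 2) := by gcongr
      _ = k₂ * k₁ * τ ^ 2 := by ring
  have hmdP : |md * P ^ 2| ≤ k₂ * (J * τ) := by
    rw [abs_mul, abs_of_pos (show 0 < P ^ 2 by positivity)]
    calc |md| * P ^ 2 ≤ k₂ * m * τ * P ^ 2 := by gcongr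
      _ = k₂ * (m * P ^ 2 * τ) := by ring
      _ ≤ k₂ * (J * τ) := by gcongr
  have hmdPτ : |md * P ^ 2 * τ| ≤ k₂ * (J * τ) := by
    rw [abs_mul, abs_of_pos hτ]
    calc |md * P ^ 2| * τ ≤ k₂ * (J * τ) * 1 := by gcongr
      _ = k₂ * (J * τ) := by ring
  have hmddP : |mdd * P ^ 2| ≤ k₂ * (J * τ) := by
    rw [abs_mul, abs_of_pos (show 0 < P ^ 2 by positivity)]
    calc |mdd| * P ^ 2 ≤ k₂ * m * τ ^ 2 * P ^ 2 := by gcongr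
      _ = k₂ * (m * P ^ 2 * τ ^ 2) := by ring
      _ ≤ k₂ * (J * τ) := by gcongr
  have hmdPS : md * (P ^ 2 * S) ≤ k₂ * (J * τ) := by
    calc md * (P ^ 2 * S) ≤ k₂ * m * τ * (P ^ 2 * S) := by gcongr
      _ = k₂ * (J * τ) := by rw [hJ]; ring
  obtain ⟨hPmd1, hPmd2⟩ := abs_le.mp hPmd
  obtain ⟨hPmdd1, hPmdd2⟩ := abs_le.mp hPmdd
  obtain ⟨hmdP1, hmdP2⟩ := abs_le.mp hmdP
  obtain ⟨hmdPτ1, hmdPτ2⟩ := abs_le.mp hmdPτ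
  obtain ⟨hmddP1, hmddP2⟩ := abs_le.mp hmddP
  have hβ1 : P * S / 2 ≤ β := by
    have e : γ * (q * P * τ) = P * (τ * (2 * γ * q)) / 2 := by ring
    have : P * (τ * (2 * γ * q)) ≤ P * S := by
      gcongr; exact h1.trans hS
    rw [hβ, e]
    linarith only [this]
  have hγq : 0 < γ * q := by positivity
  have h2J : (2 * γ * q + γ * k₂) * (J * τ) ≤ J / 2 := by
    have := mul_le_mul_of_nonneg_right h2 hJ0.le
    linarith only [this]
  have hmPγ : γ * q * (m * P ^ 2 * τ) ≤ γ * q * (J * τ) := by gcongr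
  have hmPγ0 : 0 ≤ γ * q * (m * P ^ 2 * τ) := by positivity
  have hγmd1 : γ * (md * P ^ 2) ≤ γ * (k₂ * (J * τ)) := by gcongr
  have hγmd2 : γ * (-(k₂ * (J * τ))) ≤ γ * (md * P ^ 2) := by gcongr
  have hN1 : J / 2 ≤ N := by
    have : 0 < γ * P := by positivity
    linarith only [this, hN, h2J, hmPγ, hγmd1]
  have hN3 : N ≤ 3 * J := by
    have : 0 < γ * q * (J * τ) := by positivity
    linarith only [this, hN, hγJ, h2J, hmPγ0, hγmd2, hJ0]
  have hqmP : q * (m * P * τ) ≤ q * (k₁ * τ) := by gcongr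
  have hqmP0 : 0 ≤ q * (m * P * τ) := by positivity
  refine ⟨hβ1, hN1, hN3, ?_, ?_, ?_, ?_, ?_⟩
  · have := mul_le_mul_of_nonneg_left hβ1 hk₁.le
    linarith only [this, hN3, hJk]
  · linarith only [hη, hqmP, hPmd2, h3]
  · have : 0 < q * (k₁ * τ) := by positivity
    linarith only [this, hη, hqmP0, hPmd1, h3]
  · have e1 : q * (1 - q) * P * τ ^ 2 * m ≤ k₁ * τ ^ 2 := by
      calc q * (1 - q) * P * τ ^ 2 * m = q * (1 - q) * (m * P * τ ^ 2) := by ring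
        _ ≤ 1 * (m * P * τ ^ 2) := by
          gcongr; nlinarith only [hq0, hq1]
        _ ≤ k₁ * τ ^ 2 := by linarith only [hmPττ]
    have e2 : -(2 * q * P * τ * md) ≤ 2 * (k₂ * k₁ * τ ^ 2) := by
      calc -(2 * q * P * τ * md) = 2 * q * τ * -(P * md) := by ring
        _ ≤ 2 * q * τ * (k₂ * k₁ * τ) := by gcongr; linarith only [hPmd1]
        _ ≤ 2 * 1 * τ * (k₂ * k₁ * τ) := by gcongr
        _ = 2 * (k₂ * k₁ * τ ^ 2) := by ring
    linarith only [hηd, e1, e2, hPmdd1]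
  · have hJτ : 0 < J * τ := by positivity
    have e1 : γ * (q * P * τ) ≤ q * (J * τ) := by
      calc γ * (q * P * τ) = q * (γ * P * τ) := by ring
        _ ≤ q * (J * τ) := by gcongr
    have e2 : γ * q * -(md * P ^ 2 * τ) ≤ γ * q * (k₂ * (J * τ)) := by
      gcongr; linarith only [hmdPτ1]
    have e3 : γ * q * ((1 - 2 * q) * (m * P ^ 2 * τ ^ 2)) ≤ γ * q * (J * τ) := by
      have hq : 1 - 2 * q ≤ 1 := by linarith only [hq0]
      refine mul_le_mul_of_nonneg_left ?_ hγq.le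
      calc (1 - 2 * q) * (m * P ^ 2 * τ ^ 2) ≤ 1 * (m * P ^ 2 * τ ^ 2) := by gcongr
        _ ≤ J * τ := by linarith only [hmPJττ]
    have e4 : γ * -(mdd * P ^ 2) ≤ γ * (k₂ * (J * τ)) := by
      gcongr; linarith only [hmddP1]
    have e5 : J * τ * (k₂ + (2 * q + s) + q + 2 * γ * q * k₂ + 2 * γ * q + γ * k₂
        + 2 * γ * q * k₂) ≤ a / 4 * (P * S) := by
      have e6 := mul_le_mul_of_nonneg_right h4 (show 0 ≤ P * S by positivity)
      have e7 : J * (τ * (k₂ + (2 * q + s) + q + 2 * γ * q * k₂ + 2 * γ * q + γ * k₂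
        + 2 * γ * q * k₂)) ≤ k₁ * (P * S) * (τ * (k₂ + (2 * q + s) + q + 2 * γ * q * k₂
        + 2 * γ * q + γ * k₂ + 2 * γ * q * k₂)) := by gcongr
      linarith only [e6, e7]
    have e8 : m * ((2 * q + s) * P ^ 2 * S * τ) = (2 * q + s) * (J * τ) := by rw [hJ]; ring
    have e9 := mul_le_mul_of_nonneg_left hβ1 ha.le
    linarith only [hNd, hmdPS, e1, e2, e3, e4, e5, e8, e9]

/-- Rate of decay of a function whose derivative is controlled by a slowly vanishing linear
damping and a source proportional to `m t * t ^ (a - r)`. -/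
theorem exists_forall_le_mul_rpow {E E' m m' : ℝ → ℝ} {T k κ C r a : ℝ} (hT : 0 < T)
    (hκ : 0 < κ) (hC : 0 ≤ C) (hr : r < 1) (hmpos : ∀ t ≥ T, 0 < m t)
    (hm : ∀ t ≥ T, HasDerivAt m (m' t) t) (hm' : ∀ t ≥ T, t * |m' t| ≤ k * m t)
    (hE : ∀ t ≥ T, HasDerivAt E (E' t) t)
    (hE' : ∀ t ≥ T, E' t ≤ -(κ * t ^ (-r)) * E t + C * (m t * t ^ (a - r))) :
    ∃ K > 0, ∃ T' ≥ T, ∀ t ≥ T', E t ≤ K * (m t * t ^ a) := by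
  have hlim : Tendsto (fun t : ℝ => t ^ (-(1 - r)) * (k + |a|)) atTop (𝓝 (0 * (k + |a|))) :=
    (tendsto_rpow_neg_atTop (by linarith)).mul_const _
  rw [zero_mul] at hlim
  obtain ⟨T', hT'⟩ := eventually_atTop.mp
    ((hlim.eventually_le_const (half_pos hκ)).and (eventually_ge_atTop T))
  have hTT : T ≤ T' := (hT' T' le_rfl).2
  have hT'0 : 0 < T' := hT.trans_le hTT
  have hmT : 0 < m T' * T' ^ a := mul_pos (hmpos T' hTT) (rpow_pos_of_pos hT'0 a)
  set K := 2 * C / κ + 1 + |E T'| / (m T' * T' ^ a) with hK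
  have hK1 : 2 * C / κ < K := by
    have : 0 ≤ |E T'| / (m T' * T' ^ a) := by positivity
    linarith
  have hK0 : 0 < K := lt_of_le_of_lt (by positivity) hK1
  refine ⟨K, hK0, T', hTT, ?_⟩
  refine le_of_linear_differential_inequality
    (W' := fun t => K * (m' t * t ^ a + m t * (a * t ^ (a - 1))))
    (k := fun t => κ * t ^ (-r)) (h := fun t => C * (m t * t ^ (a - r)))
    (fun t ht => hE t (hTT.trans ht)) (fun t ht => ?_) (fun t ht => hE' t (hTT.trans ht))
    (fun t ht => ?_) ?_
  · exact ((hm t (hTT.trans ht)).mul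
      (hasDerivAt_rpow_const (Or.inl (hT'0.trans_le ht).ne'))).const_mul K
  · have ht0 : 0 < t := hT'0.trans_le ht
    have hmt := hmpos t (hTT.trans ht)
    have h1 : t⁻¹ * (k + |a|) ≤ κ / 2 * t ^ (-r) := by
      have h := mul_le_mul_of_nonneg_right (hT' t ht).1 (rpow_pos_of_pos ht0 (-r)).le
      have e : t ^ (-(1 - r)) * t ^ (-r) = t⁻¹ := by
        rw [← rpow_add ht0, ← rpow_neg_one]; congr 1; ring
      rw [← e]
      linarith
    have h2 : -(k * m t * t⁻¹) ≤ m' t := by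
      have := (abs_le.mp ((le_div_iff₀' ht0).mpr (hm' t (hTT.trans ht)))).1
      rwa [div_eq_mul_inv] at this
    have hw : 0 < m t * t ^ a := mul_pos hmt (rpow_pos_of_pos ht0 a)
    have h3 : -(κ / 2 * t ^ (-r)) * (m t * t ^ a)
        ≤ m' t * t ^ a + m t * (a * t ^ (a - 1)) := by
      rw [rpow_sub_one ht0.ne', div_eq_mul_inv (t ^ a)]
      have h4 := mul_le_mul_of_nonneg_right h1 hw.le
      have h5 := mul_le_mul_of_nonneg_right h2 (rpow_pos_of_pos ht0 a).le
      have h6 : -(|a|) * (m t * t ^ a * t⁻¹) ≤ a * (m t * t ^ a * t⁻¹) := by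
        have : 0 < t⁻¹ := by positivity
        gcongr
        exact neg_abs_le a
      linarith
    have e : t ^ (a - r) = t ^ a * t ^ (-r) := by rw [← rpow_add ht0]; rfl
    have h7 := mul_le_mul_of_nonneg_left h3 hK0.le
    have h8 : C * (m t * t ^ a * t ^ (-r)) < K * (κ / 2) * (m t * t ^ a * t ^ (-r)) := by
      have : 0 < t ^ (-r) := rpow_pos_of_pos ht0 _
      have : C < K * (κ / 2) := by
        rw [div_lt_iff₀ hκ] at hK1
        linarith
      gcongr
    simp only [e]
    linarith
  · have : |E T'| / (m T' * T' ^ a) ≤ K := by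
      have : 0 ≤ 2 * C / κ := by positivity
      linarith
    rw [div_le_iff₀ hmT] at this
    exact (le_abs_self _).trans this

section Estimates

variable {X Y : Type*} [NormedAddCommGroup X] [InnerProductSpace ℝ X] [CompleteSpace X]
  [NormedAddCommGroup Y] [InnerProductSpace ℝ Y] [CompleteSpace Y]
  {f : X → ℝ} {f' : X → X} {A : X →L[ℝ] Y} {b : Y}

/-- Objective and feasibility errors in terms of the distance to the regularized saddle point and
the regularized primal gap. -/
theorem objective_and_feasibility_bounds (hconv : ConvexOn ℝ Set.univ f)
    (hf : ∀ u, HasGradientAt f (f' u) u) {ε R D δ : ℝ} {u xs w : X} {l ls : Y} (hε : 0 < ε)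
    (h1 : f' u + ContinuousLinearMap.adjoint A l + ε • u = 0) (h2 : A u - b - ε • l = 0)
    (hb : A xs = b) (hs : ∀ w, f xs ≤ f w + ⟪ls, A w - b⟫)
    (hu : ‖u‖ ≤ R) (hl : ‖l‖ ≤ R) (hxs : ‖xs‖ ≤ R) (hls : ‖ls‖ ≤ R) (hw : ‖w - u‖ ≤ δ)
    (hD : f w - f u + ⟪l, A (w - u)⟫ + ε / 2 * (‖w‖ ^ 2 - ‖u‖ ^ 2) ≤ D) :
    ‖A w - b‖ ≤ ‖A‖ * δ + ε * R ∧
      |f w - f xs| ≤ |D| + R * ‖A‖ * δ + ε * R ^ 2 ∧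
      |f w + ⟪ls, A w - b⟫ - f xs| ≤ |D| + 2 * (R * ‖A‖ * δ) + 2 * (ε * R ^ 2) := by
  have hR : 0 ≤ R := (norm_nonneg _).trans hu
  have hδ : 0 ≤ δ := (norm_nonneg _).trans hw
  have hA : ‖A (w - u)‖ ≤ ‖A‖ * δ := (A.le_opNorm _).trans (by gcongr)
  have hfeas : ‖A w - b‖ ≤ ‖A‖ * δ + ε * R := by
    have e : A w - b = A (w - u) + ε • l := by
      rw [map_sub]; linear_combination (norm := module) h2
    rw [e]
    refine (norm_add_le _ _).trans (add_le_add hA ?_)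
    rw [norm_smul, norm_of_nonneg hε.le]
    gcongr
  have hls' : |⟪ls, A w - b⟫| ≤ R * ‖A‖ * δ + ε * R ^ 2 := by
    calc |⟪ls, A w - b⟫| ≤ ‖ls‖ * ‖A w - b‖ := abs_real_inner_le_norm _ _
      _ ≤ R * (‖A‖ * δ + ε * R) := by gcongr
      _ = R * ‖A‖ * δ + ε * R ^ 2 := by ring
  have hl' : |⟪l, A (w - u)⟫| ≤ R * ‖A‖ * δ := by
    calc |⟪l, A (w - u)⟫| ≤ ‖l‖ * ‖A (w - u)‖ := abs_real_inner_le_norm _ _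
      _ ≤ R * (‖A‖ * δ) := by gcongr
      _ = R * ‖A‖ * δ := by ring
  have hu2 : ε / 2 * ‖u‖ ^ 2 ≤ ε / 2 * R ^ 2 := by gcongr
  have hxs2 : ε / 2 * ‖xs‖ ^ 2 ≤ ε / 2 * R ^ 2 := by gcongr
  have hgap := half_mul_norm_sq_le_gap (w := xs) hconv hf h1
  have e3 : A (xs - u) = -(ε • l) := by
    rw [map_sub, hb]; linear_combination (norm := module) -h2
  rw [e3, inner_neg_right, inner_smul_right, real_inner_self_eq_norm_sq] at hgap
  have hfu : f u ≤ f xs + ε / 2 * R ^ 2 := by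
    have p1 : 0 ≤ ε / 2 * ‖xs - u‖ ^ 2 := by positivity
    have p2 : 0 ≤ ε * ‖l‖ ^ 2 := by positivity
    have p3 : 0 ≤ ε / 2 * ‖u‖ ^ 2 := by positivity
    linarith
  have hw2 : 0 ≤ ε / 2 * ‖w‖ ^ 2 := by positivity
  have hsw := hs w
  obtain ⟨a1, a2⟩ := abs_le.mp hls'
  obtain ⟨a3, a4⟩ := abs_le.mp hl'
  have hDD := le_abs_self D
  have hD0 := abs_nonneg D
  have hRA : 0 ≤ R * ‖A‖ * δ := by positivity
  have hεR : 0 ≤ ε * R ^ 2 := by positivity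
  refine ⟨hfeas, abs_le.mpr ⟨?_, ?_⟩, abs_le.mpr ⟨?_, ?_⟩⟩ <;> linarith

end Estimates

theorem eventually_inv_mul_le (K : ℝ) {δ : ℝ} (hδ : 0 < δ) : ∀ᶠ t : ℝ in atTop, t⁻¹ * K ≤ δ := by
  have h : Tendsto (fun t : ℝ => t⁻¹ * K) atTop (𝓝 (0 * K)) := tendsto_inv_atTop_zero.mul_const K
  rw [zero_mul] at h
  exact h.eventually_le_const hδ

theorem norm_add_add_sq_le {V : Type*} [SeminormedAddCommGroup V] (u v w : V) :
    ‖u + v + w‖ ^ 2 ≤ 3 * (‖u‖ ^ 2 + ‖v‖ ^ 2 + ‖w‖ ^ 2) := by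
  have h : ‖u + v + w‖ ^ 2 ≤ (‖u‖ + ‖v‖ + ‖w‖) ^ 2 := by
    gcongr; exact norm_add₃_le
  nlinarith [sq_nonneg (‖u‖ - ‖v‖), sq_nonneg (‖v‖ - ‖w‖), sq_nonneg (‖u‖ - ‖w‖)]

section Coefficients

variable {m m' : ℝ → ℝ} {t md mdd : ℝ} (γ q s : ℝ)

theorem hasDerivAt_rpow_mul_inv (ht : 0 < t) :
    HasDerivAt (fun τ : ℝ => τ ^ q) (q * t ^ q * t⁻¹) t := by
  refine (hasDerivAt_rpow_const (Or.inl ht.ne')).congr_deriv ?_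
  rw [rpow_sub_one ht.ne']
  ring

theorem hasDerivAt_gap_weight (ht : 0 < t) (hm : HasDerivAt m md t) (hm' : HasDerivAt m' mdd t)
    (hmd : m' t = md) :
    HasDerivAt (fun τ => m τ * ((τ ^ q) ^ 2 * τ ^ s) + γ * τ ^ q
        - 2 * γ * q * (m τ * (τ ^ q) ^ 2 * τ⁻¹) - γ * (m' τ * (τ ^ q) ^ 2))
      (md * ((t ^ q) ^ 2 * t ^ s) + m t * ((2 * q + s) * (t ^ q) ^ 2 * t ^ s * t⁻¹)
        + γ * (q * t ^ q * t⁻¹)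
        - 2 * γ * q * (md * (t ^ q) ^ 2 * t⁻¹ + m t * ((2 * q - 1) * (t ^ q) ^ 2 * t⁻¹ ^ 2))
        - γ * (mdd * (t ^ q) ^ 2 + md * (2 * q * (t ^ q) ^ 2 * t⁻¹))) t := by
  have hP := hasDerivAt_rpow_mul_inv q ht
  have hS := hasDerivAt_rpow_mul_inv s ht
  have hP2 := hP.pow 2
  have d := (((hm.mul (hP2.mul hS)).add (hP.const_mul γ)).sub
    (((hm.mul hP2).mul (hasDerivAt_inv ht.ne')).const_mul (2 * γ * q))).sub
    ((hm'.mul hP2).const_mul γ)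
  refine d.congr_deriv ?_
  simp only [Pi.mul_apply, Pi.pow_apply, hmd]
  push_cast
  ring

theorem hasDerivAt_distance_weight (ht : 0 < t) (hm : HasDerivAt m md t)
    (hm' : HasDerivAt m' mdd t) (hmd : m' t = md) :
    HasDerivAt (fun τ => 1 - q * τ ^ q * τ⁻¹ * m τ - τ ^ q * m' τ)
      (q * (1 - q) * t ^ q * t⁻¹ ^ 2 * m t - 2 * q * t ^ q * t⁻¹ * md - t ^ q * mdd) t := by
  have hP := hasDerivAt_rpow_mul_inv q ht
  have d := (((((hP.const_mul q).mul (hasDerivAt_inv ht.ne')).mul hm).const_sub 1)).sub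
    (hP.mul hm')
  refine d.congr_deriv ?_
  simp only [Pi.mul_apply, hmd]
  ring

end Coefficients

theorem feasible_and_le_of_saddle {X Y : Type*} [NormedAddCommGroup X] [InnerProductSpace ℝ X]
    [NormedAddCommGroup Y] [InnerProductSpace ℝ Y] {f : X → ℝ} {A : X →L[ℝ] Y} {b : Y}
    {xs : X} {ls : Y}
    (h : ∀ u μ, f xs + ⟪μ, A xs - b⟫ ≤ f xs + ⟪ls, A xs - b⟫ ∧
      f xs + ⟪ls, A xs - b⟫ ≤ f u + ⟪ls, A u - b⟫) :
    A xs = b ∧ ∀ w, f xs ≤ f w + ⟪ls, A w - b⟫ := by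
  have hb : A xs - b = 0 := by
    have h1 := (h xs (ls + (A xs - b))).1
    rw [inner_add_left, real_inner_self_eq_norm_sq] at h1
    have : ‖A xs - b‖ ^ 2 = 0 := le_antisymm (by linarith) (sq_nonneg _)
    simpa using this
  refine ⟨sub_eq_zero.mp hb, fun w => ?_⟩
  have h2 := (h w ls).2
  rwa [hb, inner_zero_right, add_zero] at h2

set_option maxHeartbeats 4000000 in
theorem rates_case_small_p
    {X Y : Type*} [NormedAddCommGroup X] [InnerProductSpace ℝ X] [CompleteSpace X]
    [NormedAddCommGroup Y] [InnerProductSpace ℝ Y] [CompleteSpace Y]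
    (f : X → ℝ) (f' : X → X) (hf : ∀ u, HasGradientAt f (f' u) u)
    (hconv : ConvexOn ℝ Set.univ f)
    (A : X →L[ℝ] Y) (b : Y)
    (L : X → Y → ℝ) (hL : ∀ u lam, L u lam = f u + ⟪lam, A u - b⟫)
    (c p t₀ : ℝ) (hc : 0 < c) (hp0 : 0 < p) (hp1 : p < 1) (ht₀ : 0 < t₀)
    (Lt : ℝ → X → Y → ℝ)
    (hLt : ∀ t u lam, Lt t u lam = L u lam + (c / (2 * t ^ p)) * (‖u‖ ^ 2 - ‖lam‖ ^ 2))
    (gx : ℝ → X → Y → X)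
    (hgx : ∀ t u lam, gx t u lam = f' u + ContinuousLinearMap.adjoint A lam + (c / t ^ p) • u)
    (gl : ℝ → X → Y → Y)
    (hgl : ∀ t u lam, gl t u lam = A u - b - (c / t ^ p) • lam)
    (Om : Set (X × Y))
    (hOm : Om = {z : X × Y | ∀ u μ, L z.1 μ ≤ L z.1 z.2 ∧ L z.1 z.2 ≤ L u z.2})
    (hOmne : Om.Nonempty)
    (xs : X) (ls : Y)
    (hmem : (xs, ls) ∈ Om)
    (hmin : ∀ w ∈ Om, Real.sqrt (‖xs‖ ^ 2 + ‖ls‖ ^ 2) ≤ Real.sqrt (‖w.1‖ ^ 2 + ‖w.2‖ ^ 2))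
    (α q γ s : ℝ) (hα : 1 < α) (hq0 : 0 < q) (hq1 : q < 1) (hγ : 0 < γ) (hs : 0 < s)
    (m m' m'' : ℝ → ℝ)
    (hmpos : ∀ t ≥ t₀, 0 < m t)
    (hmmono : AntitoneOn m (Set.Ici t₀))
    (hmd : ∀ t ≥ t₀, HasDerivAt m (m' t) t)
    (hmd2 : ∀ t ≥ t₀, HasDerivAt m' (m'' t) t)
    (θ : ℝ → ℝ)
    (hθ : ∀ t, θ t = (m t * t ^ (2*q+s) + γ * t ^ q - 2 * m t * γ * q * t ^ (2*q-1)
      - γ * m' t * t ^ (2*q)) / ((α - 1) * (t ^ (q+s) - γ * q * t ^ (q-1))))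
    (k₁ k₂ T₁ T₂ : ℝ) (hk₁ : 0 < k₁) (hk₂ : 0 < k₂) (hT₁ : t₀ ≤ T₁) (hT₂ : t₀ ≤ T₂)
    (hA1 : ∀ t ≥ T₁, γ / t ^ (q+s) ≤ m t ∧ m t ≤ k₁ / t ^ q)
    (hA2 : ∀ t ≥ T₂, t * |m' t| ≤ k₂ * m t ∧ t ^ 2 * |m'' t| ≤ k₂ * m t)
    (x : ℝ → X) (lam : ℝ → Y) (x' x'' : ℝ → X) (lam' : ℝ → Y) (gder : ℝ → X)
    (hx : ∀ t ≥ t₀, HasDerivAt x (x' t) t)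
    (hx' : ∀ t ≥ t₀, HasDerivAt x' (x'' t) t)
    (hx''c : ContinuousOn x'' (Set.Ici t₀))
    (hlam : ∀ t ≥ t₀, HasDerivAt lam (lam' t) t)
    (hlamc : ContinuousOn lam' (Set.Ici t₀))
    (hgder : ∀ t ≥ t₀, HasDerivAt (fun τ => gx τ (x τ) (lam τ)) (gder t) t)
    (hode1 : ∀ t ≥ t₀, m t • x'' t + (α / t ^ q) • x' t + γ • gder t
      + t ^ s • gx t (x t) (lam t) = 0)
    (hode2 : ∀ t ≥ t₀, lam' t = ((α - 1) * (t ^ (q+s) - γ * q * t ^ (q-1)))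
      • gl t (x t + θ t • x' t) (lam t))
    (xt : ℝ → X) (lt : ℝ → Y)
    (hsaddle : ∀ t ≥ t₀, gx t (xt t) (lt t) = 0 ∧ gl t (xt t) (lt t) = 0)
    (xt' : ℝ → X) (lt' : ℝ → Y)
    (hxt : ∀ t ≥ t₀, HasDerivAt xt (xt' t) t)
    (hlt : ∀ t ≥ t₀, HasDerivAt lt (lt' t) t)
    (hxtc : ContinuousOn xt' (Set.Ici t₀))
    (hltc : ContinuousOn lt' (Set.Ici t₀))
    (r : ℝ) (hr : r = max q (p - q - s))
    (hp2 : p < (1 - q)/2)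
    (hcond1 : 4*q + s + p - 2 < 0) (hcond2 : 3*q + s - p - 1 < 0)
    :
    ((fun t => L (x t) ls - L xs ls) =O[atTop]
        (fun t => Real.sqrt (m t) * t ^ ((2*q+s-p-1+r)/2) + t ^ (-p)))
    ∧ ((fun t => |f (x t) - f xs|) =O[atTop]
        (fun t => Real.sqrt (m t) * t ^ ((2*q+s-p-1+r)/2) + t ^ (-p)))
    ∧ ((fun t => ‖A (x t) - b‖) =O[atTop]
        (fun t => Real.sqrt (m t) * t ^ ((2*q+s-p-1+r)/2) + t ^ (-p)))
    ∧ ((fun t => ‖x t - xt t‖ ^ 2 + ‖lam t - lt t‖ ^ 2) =O[atTop]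
        (fun t => m t * t ^ (2*q+s-p-1+r))) := by
  have hsad : ∀ u μ, f xs + ⟪μ, A xs - b⟫ ≤ f xs + ⟪ls, A xs - b⟫ ∧
      f xs + ⟪ls, A xs - b⟫ ≤ f u + ⟪ls, A u - b⟫ := by
    rw [hOm] at hmem
    simpa only [Set.mem_ofPred_eq, hL] using hmem
  obtain ⟨hb, hs'⟩ := feasible_and_le_of_saddle hsad
  have hsx : ∀ t ≥ t₀, f' (xt t) + ContinuousLinearMap.adjoint A (lt t)
      + (c / t ^ p) • xt t = 0 := fun t ht => by rw [← hgx]; exact (hsaddle t ht).1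
  have hsl : ∀ t ≥ t₀, A (xt t) - b - (c / t ^ p) • lt t = 0 :=
    fun t ht => by rw [← hgl]; exact (hsaddle t ht).2
  have hrq : q ≤ r := hr ▸ le_max_left _ _
  have hrp : p - q - s ≤ r := hr ▸ le_max_right _ _
  have hr1 : r < 1 := by rw [hr]; exact max_lt hq1 (by linarith)
  have hrqp : r ≤ 1 + q - p := by rw [hr]; exact max_le (by linarith) (by linarith)
  obtain ⟨a, rfl⟩ : ∃ a, α = a + 1 := ⟨α - 1, by ring⟩
  have ha : 0 < a := by linarith
  simp only [add_sub_cancel_right] at hθ hode2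
  set R := ‖xs‖ + ‖ls‖ with hRdef
  have hR : 0 ≤ R := by positivity
  have hxsR : ‖xs‖ ≤ R := le_add_of_nonneg_right (norm_nonneg _)
  have hlsR : ‖ls‖ ≤ R := le_add_of_nonneg_left (norm_nonneg _)
  have hpathR : ∀ t ≥ t₀, ‖xt t‖ ^ 2 + ‖lt t‖ ^ 2 ≤ R ^ 2 := fun t ht => by
    have h1 := norm_sq_regularized_saddle_le hconv hf
      (div_pos hc (rpow_pos_of_pos (ht₀.trans_le ht) p)) (hsx t ht) (hsl t ht) hb hs'
    have h2 : 0 ≤ ‖xs‖ * ‖ls‖ := by positivity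
    rw [hRdef, add_sq]
    linarith
  have hxtR : ∀ t ≥ t₀, ‖xt t‖ ≤ R := fun t ht =>
    le_of_sq_le_sq (by linarith [hpathR t ht, sq_nonneg ‖lt t‖]) hR
  have hltR : ∀ t ≥ t₀, ‖lt t‖ ≤ R := fun t ht =>
    le_of_sq_le_sq (by linarith [hpathR t ht, sq_nonneg ‖xt t‖]) hR
  have hveloR : ∀ t > t₀, ‖xt' t‖ ^ 2 + ‖lt' t‖ ^ 2 ≤ (R * t⁻¹) ^ 2 := fun t ht => by
    have h0 : ∀ᶠ τ in 𝓝 t, t₀ ≤ τ := eventually_ge_nhds ht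
    refine (norm_sq_deriv_regularized_saddle_le hconv hf hc hp0 hp1 (ht₀.trans ht)
      (hxt t ht.le) (hlt t ht.le) (h0.mono hsx) (h0.mono hsl)).trans ?_
    rw [mul_pow, inv_pow, ← div_eq_mul_inv]
    gcongr
    exact hpathR t ht.le
  have hxt'R : ∀ t > t₀, ‖xt' t‖ ≤ R * t⁻¹ := fun t ht =>
    le_of_sq_le_sq (by linarith [hveloR t ht, sq_nonneg ‖lt' t‖])
      (mul_nonneg hR (inv_nonneg.mpr (ht₀.trans ht).le))
  have hlt'R : ∀ t > t₀, ‖lt' t‖ ≤ R * t⁻¹ := fun t ht =>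
    le_of_sq_le_sq (by linarith [hveloR t ht, sq_nonneg ‖xt' t‖])
      (mul_nonneg hR (inv_nonneg.mpr (ht₀.trans ht).le))
  obtain ⟨κ, hκ, hκ1, hκ2, hκ3, hκ4, hκ5⟩ : ∃ κ > 0, κ * (6 * k₁) ≤ a / 2 ∧ κ * (6 * k₁) ≤ 1 ∧
      κ * (6 * γ) ≤ 1 ∧ κ * (3 * a + 1) ≤ c / 2 / 8 ∧ κ ≤ a * (c / 2) := by
    obtain ⟨z, h1, h2, h3, h4, h5, h6⟩ := ((eventually_gt_atTop (0 : ℝ)).and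
      ((eventually_inv_mul_le (6 * k₁) (half_pos ha)).and
      ((eventually_inv_mul_le (6 * k₁) one_pos).and ((eventually_inv_mul_le (6 * γ) one_pos).and
      ((eventually_inv_mul_le (3 * a + 1) (δ := c / 2 / 8) (by positivity)).and
      (eventually_inv_mul_le 1 (δ := a * (c / 2)) (by positivity))))))).exists
    exact ⟨z⁻¹, inv_pos.mpr h1, h2, h3, h4, h5, by simpa using h6⟩
  obtain ⟨T, hT⟩ := eventually_atTop.mp ((eventually_ge_atTop (1 : ℝ)).and
    ((eventually_gt_atTop t₀).and ((eventually_ge_atTop T₁).and ((eventually_ge_atTop T₂).and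
    ((eventually_inv_mul_le (2 * γ * q) one_pos).and
    ((eventually_inv_mul_le (2 * γ * q + γ * k₂) one_half_pos).and
    ((eventually_inv_mul_le (q * k₁ + k₂ * k₁) one_half_pos).and
    ((eventually_inv_mul_le (k₁ * (k₂ + (2 * q + s) + q + 2 * γ * q * k₂ + 2 * γ * q + γ * k₂
      + 2 * γ * q * k₂)) (δ := a / 4) (by positivity)).and
    (eventually_inv_mul_le (k₁ + 3 * k₂ * k₁) (δ := c / 2 / 8) (by positivity))))))))))
  set N : ℝ → ℝ := fun τ => m τ * ((τ ^ q) ^ 2 * τ ^ s) + γ * τ ^ q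
        - 2 * γ * q * (m τ * (τ ^ q) ^ 2 * τ⁻¹) - γ * (m' τ * (τ ^ q) ^ 2) with hN
  set η : ℝ → ℝ := fun τ => 1 - q * τ ^ q * τ⁻¹ * m τ - τ ^ q * m' τ with hη
  have hA1m : ∀ t ≥ T, γ ≤ m t * (t ^ q * t ^ s) ∧ m t * t ^ q ≤ k₁ := fun t ht => by
    obtain ⟨h1, -, h3, -⟩ := hT t ht
    have ht0 : 0 < t := one_pos.trans_le h1
    have h := hA1 t h3
    rwa [rpow_add ht0, div_le_iff₀ (by positivity), le_div_iff₀ (by positivity)] at h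
  have hcoef : ∀ t ≥ T, _ := fun t ht => by
    obtain ⟨h1, h2, h3, h4, h5, h6, h7, h8, -⟩ := hT t ht
    have ht0 : 0 < t := one_pos.trans_le h1
    have hd := hA2 t h4
    exact energy_coefficient_bounds (md := m' t) (mdd := m'' t)
      (N := N t) (η := η t) (one_le_rpow h1 hq0.le) (one_le_rpow h1 hs.le)
      (inv_pos.mpr ht0) (inv_le_one_of_one_le₀ h1) (hmpos t h2.le) hγ hq0 hq1 hs hk₁ hk₂
      (hA1m t ht).1 (hA1m t ht).2
      (by rw [← div_eq_mul_inv, le_div_iff₀' ht0]; exact hd.1)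
      (by rw [inv_pow, ← div_eq_mul_inv, le_div_iff₀' (by positivity)]; exact hd.2)
      rfl rfl rfl rfl rfl h5 h6 h7 h8 ha
  have hgapnn : ∀ t ≥ t₀, 0 ≤ f (x t) - f (xt t) + ⟪lt t, A (x t - xt t)⟫
      + (c / t ^ p) / 2 * (‖x t‖ ^ 2 - ‖xt t‖ ^ 2) := fun t ht => by
    have : 0 < t := ht₀.trans_le ht
    exact le_trans (by positivity) (half_mul_norm_sq_le_gap hconv hf (hsx t ht))
  set C : ℝ := a ^ 2 * R ^ 2 / (2 * κ) * (2 / (γ * c)) + 16 * a * R ^ 2 / (c / 2) * (2 / (γ * c))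
    + R ^ 2 / (2 * a * (c / 2)) * (2 / (γ * c))
    + ‖A‖ ^ 2 * R ^ 2 / a * (6 * k₁ * (1 / c ^ 2)) + p / 2 * R ^ 2 with hC
  have hC0 : 0 ≤ C := by positivity
  have hJ : ∀ t : ℝ, 0 < t → ∀ e : ℝ,
      (t ^ q) ^ 2 * t ^ s * t ^ e = t ^ (2 * q + s + e) := fun t ht e => by
    rw [← rpow_natCast, ← rpow_mul ht.le, ← rpow_add ht, ← rpow_add ht]
    congr 1
    push_cast
    ring
  have hdecay : ∀ t ≥ T, ∃ E', HasDerivAt (fun τ => N τ * (f (x τ) - f (xt τ)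
        + ⟪lt τ, A (x τ - xt τ)⟫ + (c / τ ^ p) / 2 * (‖x τ‖ ^ 2 - ‖xt τ‖ ^ 2))
        + ‖a • (x τ - xt τ) + τ ^ q • (m τ • x' τ + γ • gx τ (x τ) (lam τ))‖ ^ 2 / 2
        + η τ * (a / 2 * ‖x τ - xt τ‖ ^ 2) + ‖lam τ - lt τ‖ ^ 2 / 2) E' t ∧
      E' ≤ -(κ * t ^ (-r)) * (N t * (f (x t) - f (xt t)
        + ⟪lt t, A (x t - xt t)⟫ + (c / t ^ p) / 2 * (‖x t‖ ^ 2 - ‖xt t‖ ^ 2))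
        + ‖a • (x t - xt t) + t ^ q • (m t • x' t + γ • gx t (x t) (lam t))‖ ^ 2 / 2
        + η t * (a / 2 * ‖x t - xt t‖ ^ 2) + ‖lam t - lt t‖ ^ 2 / 2)
        + C * (3 * c) * (m t * t ^ (2 * q + s - p - 1 + r - r)) := by
    intro t ht
    obtain ⟨h1, h2, h3, h4, h5, h6, h7, h8, h9⟩ := hT t ht
    obtain ⟨c1, c2, c3, c4, c5, c6, c7, c8⟩ := hcoef t ht
    have ht0 : 0 < t := one_pos.trans_le h1
    have hm0 := hmpos t h2.le
    have hP0 : 0 < t ^ q := rpow_pos_of_pos ht0 q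
    have hS1 : 1 ≤ t ^ s := one_le_rpow h1 hs.le
    have hε0 : 0 < c / t ^ p := div_pos hc (rpow_pos_of_pos ht0 p)
    have hτ0 : 0 < t⁻¹ := inv_pos.mpr ht0
    have hρ0 : 0 < t ^ (-r) := rpow_pos_of_pos ht0 _
    set β := t ^ q * t ^ s - γ * (q * t ^ q * t⁻¹) with hβ
    have hβ0 : 0 < β := lt_of_lt_of_le (by positivity) c1
    have hN0 : 0 < N t := lt_of_lt_of_le (by positivity) c2
    have hβrw : t ^ (q + s) - γ * q * t ^ (q - 1) = β := by
      rw [hβ, rpow_add ht0, rpow_sub_one ht0.ne']; ring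
    have hθN : a * β * θ t = N t := by
      rw [hθ t, hβrw, mul_div_cancel₀ _ (by positivity)]
      have e1 : t ^ (2 * q) = (t ^ q) ^ 2 := by
        rw [← rpow_natCast, ← rpow_mul ht0.le]; congr 1; push_cast; ring
      rw [rpow_add ht0, rpow_sub_one ht0.ne', e1]
      simp only [hN]
      ring
    have hlamd : lam' t = (a * β) • (A (x t) - b - (c / t ^ p) • lam t)
        + N t • A (x' t) := by
      rw [hode2 t h2.le, hβrw, hgl, ← hθN, map_add, map_smul]
      module
    obtain ⟨E', hE', hle⟩ := exists_hasDerivAt_energy_le (a := a) (γ := γ) (β := β) (S := t ^ s)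
      (P := fun τ => τ ^ q) (N := N) (η := η) (g := fun τ => gx τ (x τ) (lam τ))
      hconv hf ht0 (hx t h2.le) (hx' t h2.le) (hxt t h2.le) (hlam t h2.le) (hlt t h2.le)
      (hgder t h2.le) (hasDerivAt_rpow_mul_inv q ht0) (hmd t h2.le)
      (hasDerivAt_gap_weight γ q s ht0 (hmd t h2.le) (hmd2 t h2.le) rfl)
      (hasDerivAt_distance_weight q ht0 (hmd t h2.le) (hmd2 t h2.le) rfl)
      hP0.ne' rfl (by simp only [hη]) hβ (by simp only [hN, hη, hβ]; ring) (hode1 t h2.le)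
      (hgx t _ _) hlamd (hsx t h2.le) (hsl t h2.le) ha.le hβ0.le
    refine ⟨E', hE', hle.trans ?_⟩
    set y := x t - xt t
    set ℓ := lam t - lt t
    set g := gx t (x t) (lam t)
    set v := a • y + t ^ q • (m t • x' t + γ • g) with hv
    have hV : ‖v‖ ^ 2 ≤ 3 * (a ^ 2 * ‖y‖ ^ 2 + (m t * t ^ q) ^ 2 * ‖x' t‖ ^ 2
        + γ ^ 2 * (t ^ q) ^ 2 * ‖g‖ ^ 2) := by
      have e : v = a • y + (m t * t ^ q) • x' t + (γ * t ^ q) • g := by rw [hv]; module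
      have := norm_add_add_sq_le (a • y) ((m t * t ^ q) • x' t) ((γ * t ^ q) • g)
      simpa only [← e, norm_smul, mul_pow, norm_eq_abs, sq_abs] using this
    have hJP : γ * t ^ q ≤ m t * ((t ^ q) ^ 2 * t ^ s) := by
      have := mul_le_mul_of_nonneg_right (hA1m t ht).1 hP0.le
      linarith
    have hτρ : t⁻¹ ≤ t ^ (-r) := by
      rw [← rpow_neg_one]
      exact rpow_le_rpow_of_exponent_le h1 (by linarith)
    have hερ : c / 2 * t ^ (-r) ≤ β * (c / t ^ p) := by
      have e : t ^ (-r) ≤ t ^ q * t ^ s / t ^ p := by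
        rw [← rpow_add ht0, ← rpow_sub ht0]
        exact rpow_le_rpow_of_exponent_le h1 (by linarith)
      calc c / 2 * t ^ (-r) ≤ c / 2 * (t ^ q * t ^ s / t ^ p) := by gcongr
        _ = t ^ q * t ^ s / 2 * (c / t ^ p) := by ring
        _ ≤ β * (c / t ^ p) := by gcongr
    have hηd : q * (1 - q) * t ^ q * t⁻¹ ^ 2 * m t - 2 * q * t ^ q * t⁻¹ * m' t - t ^ q * m'' t
        ≤ c / 2 / 8 * t ^ (-r) := by
      calc _ ≤ (k₁ + 3 * k₂ * k₁) * t⁻¹ ^ 2 := c7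
        _ = t⁻¹ * (k₁ + 3 * k₂ * k₁) * t⁻¹ := by ring
        _ ≤ c / 2 / 8 * t ^ (-r) := by gcongr
    have hτ2 : t⁻¹ ^ 2 ≤ t ^ (-r) * (2 / (γ * c) * (N t * (c / t ^ p) * t⁻¹)) := by
      have e : t⁻¹ ≤ t ^ (-r) * t ^ q / t ^ p := by
        rw [← rpow_neg_one, ← rpow_add ht0, ← rpow_sub ht0]
        exact rpow_le_rpow_of_exponent_le h1 (by linarith)
      calc t⁻¹ ^ 2 = t⁻¹ * t⁻¹ := sq _
        _ ≤ t ^ (-r) * t ^ q / t ^ p * t⁻¹ := by gcongr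
        _ = t ^ (-r) * (2 / (γ * c) * (γ * t ^ q / 2 * (c / t ^ p) * t⁻¹)) := by field_simp
        _ ≤ t ^ (-r) * (2 / (γ * c) * (N t * (c / t ^ p) * t⁻¹)) := by
          gcongr; linarith
    have hτε : t⁻¹ ≤ 1 / c ^ 2 * (c / t ^ p) ^ 2 := by
      have e : 1 / c ^ 2 * (c / t ^ p) ^ 2 = t ^ (-p * 2) := by
        rw [rpow_mul ht0.le, rpow_neg ht0.le, rpow_two]; field_simp
      rw [e, ← rpow_neg_one]
      exact rpow_le_rpow_of_exponent_le h1 (by linarith)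
    have hPβ : t ^ q ≤ 2 * β := by
      have := mul_le_mul_of_nonneg_left hS1 hP0.le
      linarith
    have hD : 0 ≤ f (x t) - f (xt t) + ⟪lt t, A y⟫
        + (c / t ^ p) / 2 * (‖x t‖ ^ 2 - ‖xt t‖ ^ 2) := hgapnn t h2.le
    have hbal := energy_balance_le (G := ‖g‖) (W := ‖x' t‖) (L := ‖ℓ‖) (p := p) (nA := ‖A‖)
      hD (norm_nonneg y) ha hβ0 hε0 hρ0
      (rpow_le_one_of_one_le_of_nonpos h1 (by linarith)) hτ0 hR hγ hP0 (half_pos hc)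
      (by positivity : 0 ≤ m t * t ^ q) hN0.le hκ c5 c6 hV c8 c4 hερ (hA1m t ht).2 hPβ hηd hτ2
      hτε hκ1 hκ2 hκ3 hκ4 hκ5
    rw [← hC] at hbal
    have i1 : -(a * ⟪v, xt' t⟫) ≤ a * ‖v‖ * (R * t⁻¹) := by
      have h := (neg_le_abs _).trans (abs_real_inner_le_norm v (xt' t))
      calc -(a * ⟪v, xt' t⟫) = a * -⟪v, xt' t⟫ := by ring
        _ ≤ a * (‖v‖ * (R * t⁻¹)) := by
          gcongr; exact h.trans (by gcongr; exact hxt'R t h2)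
        _ = _ := by ring
    have i2 : -(η t * a * ⟪y, xt' t⟫) ≤ η t * a * (‖y‖ * (R * t⁻¹)) := by
      have h := (neg_le_abs _).trans (abs_real_inner_le_norm y (xt' t))
      have hη0 : 0 ≤ η t := by linarith
      calc -(η t * a * ⟪y, xt' t⟫) = η t * a * -⟪y, xt' t⟫ := by ring
        _ ≤ η t * a * (‖y‖ * (R * t⁻¹)) := by
          gcongr; exact h.trans (by gcongr; exact hxt'R t h2)
    have i3 : -⟪ℓ, lt' t⟫ ≤ ‖ℓ‖ * (R * t⁻¹) :=
      ((neg_le_abs _).trans (abs_real_inner_le_norm ℓ (lt' t))).trans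
        (by gcongr; exact hlt'R t h2)
    have i4 : N t * ⟪lt' t, A y⟫ ≤ N t * (R * t⁻¹ * (‖A‖ * ‖y‖)) := by
      gcongr
      exact (real_inner_le_norm _ _).trans (by gcongr; exacts [hlt'R t h2, A.le_opNorm y])
    have i5 : -(N t * (p * (c / t ^ p) / t / 2) * (‖x t‖ ^ 2 - ‖xt t‖ ^ 2))
        ≤ N t * (p * (c / t ^ p) * t⁻¹ / 2) * R ^ 2 := by
      rw [← div_eq_mul_inv (p * (c / t ^ p)) t, ← mul_neg]
      have hx2 : -(‖x t‖ ^ 2 - ‖xt t‖ ^ 2) ≤ R ^ 2 := by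
        linarith [hpathR t h2.le, sq_nonneg ‖lt t‖, sq_nonneg ‖x t‖]
      gcongr
    have hsrc : N t * (c / t ^ p) * t⁻¹ ≤ 3 * c * (m t * t ^ (2 * q + s - p - 1 + r - r)) := by
      have e : (t ^ q) ^ 2 * t ^ s * (t ^ p)⁻¹ * t⁻¹ = t ^ (2 * q + s - p - 1 + r - r) := by
        rw [← rpow_neg ht0.le, ← rpow_neg_one, mul_assoc, ← rpow_add ht0, hJ t ht0]
        congr 1; ring
      calc N t * (c / t ^ p) * t⁻¹ ≤ 3 * (m t * ((t ^ q) ^ 2 * t ^ s)) * (c / t ^ p) * t⁻¹ := by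
            gcongr
        _ = 3 * c * (m t * t ^ (2 * q + s - p - 1 + r - r)) := by rw [← e]; ring
    have hsrc' := mul_le_mul_of_nonneg_left hsrc hC0
    linarith only [hbal, i1, i2, i3, i4, i5, hsrc']
  choose! E' hE' hE'le using hdecay
  have hTpos : 0 < T := one_pos.trans_le (hT T le_rfl).1
  obtain ⟨K, hK, T', hTT', hrate⟩ := exists_forall_le_mul_rpow (k := k₂)
    (C := C * (3 * c)) hTpos hκ (by positivity) hr1
    (fun t ht => hmpos t (hT t ht).2.1.le) (fun t ht => hmd t (hT t ht).2.1.le)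
    (fun t ht => (hA2 t (hT t ht).2.2.2.1).1) hE' hE'le
  have hfinal : ∀ t ≥ T', ‖x t - xt t‖ ^ 2 ≤ 4 * K / a * (m t * t ^ (2 * q + s - p - 1 + r)) ∧
      ‖lam t - lt t‖ ^ 2 ≤ 2 * K * (m t * t ^ (2 * q + s - p - 1 + r)) ∧
      f (x t) - f (xt t) + ⟪lt t, A (x t - xt t)⟫
        + (c / t ^ p) / 2 * (‖x t‖ ^ 2 - ‖xt t‖ ^ 2) ≤ 2 * K * t ^ (-p) := by
    intro t ht'
    have ht := hTT'.trans ht'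
    obtain ⟨h1, h2, -⟩ := hT t ht
    obtain ⟨-, c2, -, -, c5, -⟩ := hcoef t ht
    have ht0 : 0 < t := one_pos.trans_le h1
    have hm0 := hmpos t h2.le
    have hD := hgapnn t h2.le
    have hE := hrate t ht'
    have hJ0 : 0 < m t * ((t ^ q) ^ 2 * t ^ s) := by positivity
    have hND := mul_le_mul_of_nonneg_right c2 hD
    have hND0 := mul_nonneg hJ0.le hD
    have hηY : 1 / 2 * (a / 2 * ‖x t - xt t‖ ^ 2) ≤ η t * (a / 2 * ‖x t - xt t‖ ^ 2) := by gcongr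
    have hY0 : 0 ≤ a / 2 * ‖x t - xt t‖ ^ 2 := by positivity
    have hV0 := sq_nonneg ‖a • (x t - xt t) + t ^ q • (m t • x' t + γ • gx t (x t) (lam t))‖
    have hL0 := sq_nonneg ‖lam t - lt t‖
    refine ⟨?_, ?_, ?_⟩
    · rw [div_mul_eq_mul_div, le_div_iff₀ ha]
      linarith
    · linarith
    · have e : m t * t ^ (2 * q + s - p - 1 + r)
          = m t * ((t ^ q) ^ 2 * t ^ s) * t ^ (r - 1 - p) := by
        rw [mul_assoc, hJ t ht0]; congr 2; ring
      have e2 : t ^ (r - 1 - p) ≤ t ^ (-p) :=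
        rpow_le_rpow_of_exponent_le h1 (by linarith)
      refine le_trans ?_ (mul_le_mul_of_nonneg_left e2 (by positivity : 0 ≤ 2 * K))
      refine le_of_mul_le_mul_left ?_ hJ0
      rw [e] at hE
      linarith
  have hbounds : ∀ t ≥ T', _ := fun t ht' => by
    obtain ⟨h1, h2, -⟩ := hT t (hTT'.trans ht')
    have ht0 : 0 < t := one_pos.trans_le h1
    obtain ⟨hY, -, hD⟩ := hfinal t ht'
    have hδ : ‖x t - xt t‖
        ≤ √(4 * K / a) * (√(m t) * t ^ ((2 * q + s - p - 1 + r) / 2)) := by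
      refine le_of_sq_le_sq ?_ (by positivity)
      rw [mul_pow, mul_pow, sq_sqrt (by positivity), sq_sqrt (hmpos t h2.le).le,
        ← rpow_mul_natCast ht0.le]
      rwa [Nat.cast_ofNat, div_mul_cancel₀ _ two_ne_zero]
    exact objective_and_feasibility_bounds hconv hf (div_pos hc (rpow_pos_of_pos ht0 p))
      (hsx t h2.le) (hsl t h2.le) hb hs' (hxtR t h2.le) (hltR t h2.le) hxsR hlsR hδ hD
  have hLxs : L xs ls = f xs := by rw [hL, hb, sub_self, inner_zero_right, add_zero]
  have hscale : ∀ t ≥ T', 0 ≤ √(m t) * t ^ ((2 * q + s - p - 1 + r) / 2) ∧ 0 < t ^ (-p) ∧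
      c / t ^ p = c * t ^ (-p) ∧ |2 * K * t ^ (-p)| = 2 * K * t ^ (-p) := fun t ht' => by
    have ht0 : 0 < t := one_pos.trans_le (hT t (hTT'.trans ht')).1
    exact ⟨by positivity, by positivity, by rw [rpow_neg ht0.le]; ring, abs_of_pos (by positivity)⟩
  set k₃ := √(4 * K / a)
  have hk₃ : 0 ≤ k₃ := sqrt_nonneg _
  have hlin : ∀ {u v G H : ℝ}, 0 ≤ u → 0 ≤ v → 0 ≤ G → 0 ≤ H →
      u * G + v * H ≤ (u + v) * (G + H) := fun hu hv hG hH => by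
    linarith [mul_nonneg hu hH, mul_nonneg hv hG]
  refine ⟨IsBigO.of_bound (2 * (R * ‖A‖ * k₃) + (2 * K + 2 * (c * R ^ 2))) ?_,
    IsBigO.of_bound (R * ‖A‖ * k₃ + (2 * K + c * R ^ 2)) ?_,
    IsBigO.of_bound (‖A‖ * k₃ + c * R) ?_, IsBigO.of_bound (4 * K / a + 2 * K) ?_⟩
  all_goals
    filter_upwards [eventually_ge_atTop T'] with t ht'
    obtain ⟨s1, s2, s3, s4⟩ := hscale t ht'
    obtain ⟨b1, b2, b3⟩ := hbounds t ht'
    rw [s3] at b1 b2 b3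
    rw [s4] at b2 b3
  · rw [norm_of_nonneg (add_nonneg s1 s2.le), norm_eq_abs, hLxs, hL]
    refine le_trans ?_ (hlin (by positivity) (by positivity) s1 s2.le)
    linarith
  · rw [norm_of_nonneg (add_nonneg s1 s2.le), norm_eq_abs, abs_abs]
    refine le_trans ?_ (hlin (by positivity) (by positivity) s1 s2.le)
    linarith
  · rw [norm_of_nonneg (add_nonneg s1 s2.le), norm_norm]
    refine le_trans ?_ (hlin (by positivity) (by positivity) s1 s2.le)
    linarith
  · obtain ⟨f1, f2, -⟩ := hfinal t ht'
    obtain ⟨h1, h2, -⟩ := hT t (hTT'.trans ht')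
    have ht0 : 0 < t := one_pos.trans_le h1
    have hm0 := hmpos t h2.le
    rw [norm_of_nonneg (by positivity), norm_of_nonneg (by positivity)]
    linarith
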